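/- Consider problem (PC): minimize J[x] = ∫₀¹ f(x(t), t) dt + q(x(1)) over feasible arcs, where an arc x : [0,1] → ℝⁿ is feasible if x is differentiable on [0,1] with derivative x', x' is differentiable on [0,1] with derivative x'', x'' is integrable on [0,1], W_k(x(t), x'(t), x''(t)) ≤ 0 for almost every t ∈ [0,1] and every k = 1, …, m, and x(0) = v₀, x'(0) = v₁. Assume each f(·, t) : ℝⁿ → ℝ is convex and differentiable, t ↦ f(x(t), t) is integrable for every feasible arc x, each W_k : ℝⁿ × ℝⁿ × ℝⁿ → ℝ is convex, and q : ℝⁿ → ℝ is convex. Let x̃ be a feasible arc, and suppose there exist functions x*, ψ* : [0,1] → ℝⁿ, with x* twice differentiable and ψ* differentiable on [0,1] and with x*'' and ψ*' integrable, and measurable functions α_k : [0,1] → [0,∞) (k = 1, …, m), such that for almost every t ∈ [0,1]: (i) there exist subgradients s_k(t) ∈ ∂W_k(x̃(t), x̃'(t), x̃''(t)) with (x*''(t) + ψ*'(t) − ∇f(x̃(t), t), ψ*(t), −x*(t)) = ∑_{k=1}^m α_k(t) s_k(t); (ii) α_k(t) · W_k(x̃(t), x̃'(t), x̃''(t)) =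 0 for every k; and (iii) −ψ*(1) − x*'(1) is a subgradient of q at x̃(1) and x*(1) = 0. Then x̃ is optimal: J[x] ≥ J[x̃] for every feasible arc x. -/

import Mathlib

open scoped RealInnerProductSpace
open Set MeasureTheory

noncomputable section

abbrev E (n : ℕ) := EuclideanSpace ℝ (Fin n)

/-- The product inner product on `ℝⁿ × ℝⁿ × ℝⁿ`. -/
def inner3 {n : ℕ} (a b : E n × E n × E n) : ℝ :=
  ⟪a.1, b.1⟫ + ⟪a.2.1, b.2.1⟫ + ⟪a.2.2, b.2.2⟫

/-- `s` is a subgradient of `g : ℝⁿ × ℝⁿ × ℝⁿ → ℝ` at `x`. -/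
def IsSubgrad3 {n : ℕ} (g : E n × E n × E n → ℝ) (x s : E n × E n × E n) : Prop :=
  ∀ y, g y - g x ≥ inner3 s (y - x)

/-- The product inner product on `ℝⁿ × ℝⁿ`. -/
def inner2 {n : ℕ} (a b : E n × E n) : ℝ :=
  ⟪a.1, b.1⟫ + ⟪a.2, b.2⟫

/-- `s` is a subgradient of `g : ℝⁿ × ℝⁿ → ℝ` at `x`. -/
def IsSubgrad2 {n : ℕ} (g : E n × E n → ℝ) (x s : E n × E n) : Prop :=
  ∀ y, g y - g x ≥ inner2 s (y - x)

/-- `s` is a subgradient of `g : ℝⁿ → ℝ` at `x`. -/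
def IsSubgrad1 {n : ℕ} (g : E n → ℝ) (x s : E n) : Prop :=
  ∀ y, g y - g x ≥ ⟪s, y - x⟫

/-- Feasible arcs for problem (PC): `x` is differentiable on `[0,1]` with
derivative `x'`, `x'` is differentiable on `[0,1]` with derivative `x''`,
`x''` is integrable, the inequality constraints hold a.e. on `[0,1]`, and the
initial conditions hold. -/
def FeasiblePC (n m : ℕ) (W : Fin m → E n × E n × E n → ℝ) (v0 v1 : E n)
    (x x' x'' : ℝ → E n) : Prop :=
  (∀ t ∈ Icc (0 : ℝ) 1, HasDerivWithinAt x (x' t) (Icc 0 1) t) ∧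
  (∀ t ∈ Icc (0 : ℝ) 1, HasDerivWithinAt x' (x'' t) (Icc 0 1) t) ∧
  IntegrableOn x'' (Icc (0 : ℝ) 1) ∧
  (∀ᵐ t : ℝ ∂volume, t ∈ Icc (0 : ℝ) 1 → ∀ k, W k (x t, x' t, x'' t) ≤ 0) ∧
  x 0 = v0 ∧ x' 0 = v1

/-- The Bolza cost functional of problem (PC). -/
def J (n : ℕ) (f : ℝ → E n → ℝ) (q : E n → ℝ) (x : ℝ → E n) : ℝ :=
  (∫ t in (0 : ℝ)..1, f t (x t)) + q (x 1)

/-- The first-order lower bound of a differentiable convex function by its gradient. -/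
theorem ConvexOn.inner_gradient_le_sub {F : Type*} [NormedAddCommGroup F] [InnerProductSpace ℝ F]
    [CompleteSpace F] {g : F → ℝ} {x : F} (hg : ConvexOn ℝ univ g) (hd : DifferentiableAt ℝ g x)
    (y : F) : ⟪gradient g x, y - x⟫ ≤ g y - g x := by
  have hconv : ConvexOn ℝ univ (g ∘ AffineMap.lineMap (k := ℝ) x y) := hg.comp_affineMap _
  have hderiv : HasDerivAt (g ∘ AffineMap.lineMap (k := ℝ) x y) ⟪gradient g x, y - x⟫ 0 := by
    have hline : HasFDerivAt g (InnerProductSpace.toDual ℝ F (gradient g x))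
        (AffineMap.lineMap (k := ℝ) x y 0) := by
      simpa using hd.hasGradientAt.hasFDerivAt
    simpa using hline.comp_hasDerivAt (0 : ℝ) AffineMap.hasDerivAt_lineMap
  simpa [slope_def_field] using
    hconv.le_slope_of_hasDerivAt (mem_univ 0) (mem_univ 1) zero_lt_one hderiv

theorem MeasureTheory.IntegrableOn.continuousOn_inner {F : Type*} [NormedAddCommGroup F]
    [InnerProductSpace ℝ F] {K : Set ℝ} {u w : ℝ → F} (hw : IntegrableOn w K)
    (hu : ContinuousOn u K) (hK : IsCompact K) : IntegrableOn (fun t => ⟪u t, w t⟫) K := by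
  obtain ⟨C, hC⟩ := hK.exists_bound_of_continuousOn hu
  refine (hw.norm.const_mul C).mono'
    ((hu.aestronglyMeasurable hK.measurableSet).inner hw.aestronglyMeasurable)
    (ae_restrict_of_forall_mem hK.measurableSet fun t ht => ?_)
  exact (norm_inner_le_norm _ _).trans (by gcongr; exact hC t ht)

theorem inner3_sum_smul {n : ℕ} {ι : Type*} (s : Finset ι) (a : ι → ℝ)
    (v : ι → E n × E n × E n) (w : E n × E n × E n) :
    inner3 (∑ k ∈ s, a k • v k) w = ∑ k ∈ s, a k * inner3 (v k) w := by
  simp only [inner3, Prod.fst_sum, Prod.snd_sum, Prod.smul_fst, Prod.smul_snd, sum_inner,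
    real_inner_smul_left, mul_add, Finset.sum_add_distrib]

/-- A nonnegative combination of subgradients of constraints satisfying complementary slackness
lies in the normal cone to the feasible set. -/
theorem inner3_sum_smul_nonpos {n m : ℕ} {W : Fin m → E n × E n × E n → ℝ}
    {z y : E n × E n × E n} {a : Fin m → ℝ} {s : Fin m → E n × E n × E n}
    (hs : ∀ k, IsSubgrad3 (W k) z (s k)) (ha : ∀ k, 0 ≤ a k) (hslack : ∀ k, a k * W k z = 0)
    (hy : ∀ k, W k y ≤ 0) : inner3 (∑ k, a k • s k) (y - z) ≤ 0 := by
  rw [inner3_sum_smul]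
  refine Finset.sum_nonpos fun k _ => ?_
  have h := mul_le_mul_of_nonneg_left (hs k y) (ha k)
  have h' := mul_nonpos_of_nonneg_of_nonpos (ha k) (hy k)
  rw [mul_sub, hslack k] at h
  linarith

/-- Lagrange's identity for the second-order adjoint system, integrated over `[0,1]` along a
variation `h` vanishing to first order at `0`, when the multiplier `p` vanishes at `1`. -/
theorem integral_adjoint_identity {F : Type*} [NormedAddCommGroup F] [InnerProductSpace ℝ F]
    {h h' h'' p p' p'' r r' : ℝ → F}
    (hh : ∀ t ∈ Icc (0 : ℝ) 1, HasDerivWithinAt h (h' t) (Icc 0 1) t)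
    (hh' : ∀ t ∈ Icc (0 : ℝ) 1, HasDerivWithinAt h' (h'' t) (Icc 0 1) t)
    (hp : ∀ t ∈ Icc (0 : ℝ) 1, HasDerivWithinAt p (p' t) (Icc 0 1) t)
    (hp' : ∀ t ∈ Icc (0 : ℝ) 1, HasDerivWithinAt p' (p'' t) (Icc 0 1) t)
    (hr : ∀ t ∈ Icc (0 : ℝ) 1, HasDerivWithinAt r (r' t) (Icc 0 1) t)
    (hhint : IntegrableOn h'' (Icc (0 : ℝ) 1)) (hpint : IntegrableOn p'' (Icc (0 : ℝ) 1))
    (hrint : IntegrableOn r' (Icc (0 : ℝ) 1))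
    (h0 : h 0 = 0) (h0' : h' 0 = 0) (hp1 : p 1 = 0) :
    IntervalIntegrable (fun t => ⟪p'' t + r' t, h t⟫ + ⟪r t, h' t⟫ - ⟪p t, h'' t⟫) volume 0 1 ∧
      ∫ t in (0 : ℝ)..1, (⟪p'' t + r' t, h t⟫ + ⟪r t, h' t⟫ - ⟪p t, h'' t⟫) =
        ⟪r 1 + p' 1, h 1⟫ := by
  have hcont {u u' : ℝ → F}
      (hu : ∀ t ∈ Icc (0 : ℝ) 1, HasDerivWithinAt u (u' t) (Icc 0 1) t) :
      ContinuousOn u (Icc 0 1) := fun t ht => (hu t ht).continuousWithinAt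
  have hint : IntegrableOn (fun t => ⟪p'' t + r' t, h t⟫ + ⟪r t, h' t⟫ - ⟪p t, h'' t⟫)
      (Icc (0 : ℝ) 1) := by
    refine Integrable.sub (Integrable.add ?_ ?_) (hhint.continuousOn_inner (hcont hp) isCompact_Icc)
    · simpa only [real_inner_comm, IntegrableOn, Pi.add_apply] using
        (hpint.add hrint).continuousOn_inner (hcont hh) isCompact_Icc
    · exact ((hcont hr).inner (hcont hh')).integrableOn_Icc
  have hderiv : ∀ t ∈ Icc (0 : ℝ) 1,
      HasDerivWithinAt (fun t => ⟪p' t, h t⟫ - ⟪p t, h' t⟫ + ⟪r t, h t⟫)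
        (⟪p'' t + r' t, h t⟫ + ⟪r t, h' t⟫ - ⟪p t, h'' t⟫) (Icc 0 1) t := by
    intro t ht
    refine ((((hp' t ht).inner ℝ (hh t ht)).sub ((hp t ht).inner ℝ (hh' t ht))).add
      ((hr t ht).inner ℝ (hh t ht))).congr_deriv ?_
    rw [inner_add_left]
    ring
  have hii := (intervalIntegrable_iff_integrableOn_Icc_of_le zero_le_one).2 hint
  refine ⟨hii, ?_⟩
  rw [intervalIntegral.integral_eq_sub_of_hasDerivAt_of_le zero_le_one
    (fun t ht => (hderiv t ht).continuousWithinAt)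
    (fun t ht => (hderiv t (Ioo_subset_Icc_self ht)).hasDerivAt (Icc_mem_nhds ht.1 ht.2)) hii]
  simp [h0, h0', hp1, inner_add_left, add_comm]

theorem stmt10 (n m : ℕ) (v0 v1 : E n)
    (f : ℝ → E n → ℝ) (q : E n → ℝ)
    (W : Fin m → E n × E n × E n → ℝ)
    (hfconv : ∀ t, ConvexOn ℝ univ (f t))
    (hfdiff : ∀ t, Differentiable ℝ (f t))
    (hfint : ∀ x x' x'' : ℝ → E n, FeasiblePC n m W v0 v1 x x' x'' →
      IntervalIntegrable (fun t => f t (x t)) volume 0 1)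
    (hWconv : ∀ k, ConvexOn ℝ univ (W k))
    (hqconv : ConvexOn ℝ univ q)
    (xtil xtil' xtil'' : ℝ → E n)
    (hfeas : FeasiblePC n m W v0 v1 xtil xtil' xtil'')
    (xs xs' xs'' ψs ψs' : ℝ → E n)
    (hxs : ∀ t ∈ Icc (0 : ℝ) 1, HasDerivWithinAt xs (xs' t) (Icc 0 1) t)
    (hxs' : ∀ t ∈ Icc (0 : ℝ) 1, HasDerivWithinAt xs' (xs'' t) (Icc 0 1) t)
    (hψs : ∀ t ∈ Icc (0 : ℝ) 1, HasDerivWithinAt ψs (ψs' t) (Icc 0 1) t)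
    (hxsint : IntegrableOn xs'' (Icc (0 : ℝ) 1))
    (hψsint : IntegrableOn ψs' (Icc (0 : ℝ) 1))
    (α : Fin m → ℝ → ℝ)
    (hαmeas : ∀ k, Measurable (α k))
    (hαpos : ∀ k, ∀ t ∈ Icc (0 : ℝ) 1, 0 ≤ α k t)
    -- (i) the second order adjoint differential inclusion and
    -- (ii) complementary slackness, a.e. on [0,1]
    (hadj : ∀ᵐ t : ℝ ∂volume, t ∈ Icc (0 : ℝ) 1 →
      (∃ sk : Fin m → E n × E n × E n,
        (∀ k, IsSubgrad3 (W k) (xtil t, xtil' t, xtil'' t) (sk k)) ∧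
        (xs'' t + ψs' t - gradient (f t) (xtil t), ψs t, -xs t) =
          ∑ k, α k t • sk k) ∧
      (∀ k, α k t * W k (xtil t, xtil' t, xtil'' t) = 0))
    -- (iii) transversality conditions
    (htrans : IsSubgrad1 q (xtil 1) (-ψs 1 - xs' 1))
    (hend : xs 1 = 0) :
    ∀ x x' x'' : ℝ → E n, FeasiblePC n m W v0 v1 x x' x'' →
      J n f q x ≥ J n f q xtil := by
  intro x x' x'' hx
  have hfx := hfint x x' x'' hx
  have hft := hfint xtil xtil' xtil'' hfeas
  obtain ⟨hx1, hx2, hxint, hxW, hx0, hx0'⟩ := hx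
  obtain ⟨ht1, ht2, htint, -, ht0, ht0'⟩ := hfeas
  obtain ⟨hint, heq⟩ := integral_adjoint_identity
    (h := fun t => x t - xtil t) (h' := fun t => x' t - xtil' t)
    (h'' := fun t => x'' t - xtil'' t)
    (fun t ht => (hx1 t ht).sub (ht1 t ht)) (fun t ht => (hx2 t ht).sub (ht2 t ht))
    hxs hxs' hψs (hxint.sub htint) hxsint hψsint
    (by simp [hx0, ht0]) (by simp [hx0', ht0']) hend
  have hmono := intervalIntegral.integral_mono_ae_restrict zero_le_one hint (hfx.sub hft) <| by
    refine (ae_restrict_iff' measurableSet_Icc).2 ?_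
    filter_upwards [hxW, hadj] with t hW hadjt ht
    obtain ⟨⟨sk, hsk, hsum⟩, hslack⟩ := hadjt ht
    have hnormal := inner3_sum_smul_nonpos hsk (fun k => hαpos k t ht) hslack (hW ht)
    have hgrad := (hfconv t).inner_gradient_le_sub (hfdiff t (xtil t)) (x t)
    rw [← hsum] at hnormal
    simp only [inner3, Prod.fst_sub, Prod.snd_sub, inner_neg_left] at hnormal
    rw [inner_sub_left] at hnormal
    linarith
  rw [heq, intervalIntegral.integral_sub hfx hft] at hmono
  have hq := htrans (x 1)
  rw [← neg_add', inner_neg_left] at hq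
  simp only [J]
  linarith
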